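/- Let L = A_9 ⊕ A_9 ⊕ A_1, α = (α_9, 2α_9, α_1), and Λ = L + ℤα. Then Λ is an integral lattice, Λ ⊆ L^*, the discriminant of Λ is 2, and Λ/L is cyclic of order 10. -/

import Mathlib

noncomputable section

/-- The ambient space ℝ¹⁰ ⊕ ℝ¹⁰ ⊕ ℝ². -/
abbrev V : Type := (Fin 10 → ℝ) × (Fin 10 → ℝ) × (Fin 2 → ℝ)

/-- The standard inner product on ℝ¹⁰ ⊕ ℝ¹⁰ ⊕ ℝ². -/
def ip (x y : V) : ℝ :=
  (∑ t, x.1 t * y.1 t) + (∑ t, x.2.1 t * y.2.1 t) + (∑ t, x.2.2 t * y.2.2 t)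

/-- The root lattice A₉ ⊆ ℝ¹⁰. -/
def A9 : Set (Fin 10 → ℝ) := {x | (∀ i, ∃ z : ℤ, x i = (z : ℝ)) ∧ ∑ i, x i = 0}

/-- The root lattice A₁ ⊆ ℝ². -/
def A1 : Set (Fin 2 → ℝ) := {x | (∀ i, ∃ z : ℤ, x i = (z : ℝ)) ∧ ∑ i, x i = 0}

/-- The lattice L = A₉ ⊕ A₉ ⊕ A₁. -/
def Lset : Set V := {v | v.1 ∈ A9 ∧ v.2.1 ∈ A9 ∧ v.2.2 ∈ A1}

/-- α₉ = (1/10, …, 1/10, −9/10). -/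
def α9 : Fin 10 → ℝ := fun i => if (i : ℕ) = 9 then -(9 / 10) else 1 / 10

/-- α₁ = (1/2, −1/2). -/
def α1 : Fin 2 → ℝ := fun i => if (i : ℕ) = 1 then -(1 / 2) else 1 / 2

/-- α = (α₉, 2α₉, α₁). -/
def αvec : V := (α9, (2 : ℝ) • α9, α1)

/-- The overlattice Λ = L + ℤα. -/
def Λset : Set V := {v | ∃ m : ℤ, v - m • αvec ∈ Lset}

/-- The switching root r = (0, 0, 2α₁) = (0, 0, (1, −1)). -/
def rvec : V := (0, 0, (2 : ℝ) • α1)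


/-- The standard inner product as a bilinear form. -/
def ipForm : LinearMap.BilinForm ℝ V :=
  LinearMap.mk₂ ℝ ip
    (fun x y z => by simp only [ip, Prod.fst_add, Prod.snd_add, Pi.add_apply, add_mul,
      Finset.sum_add_distrib]; ring)
    (fun c x y => by simp only [ip, Prod.smul_fst, Prod.smul_snd, Pi.smul_apply, smul_eq_mul,
      mul_assoc, ← Finset.mul_sum]; ring)
    (fun x y z => by simp only [ip, Prod.fst_add, Prod.snd_add, Pi.add_apply, mul_add,
      Finset.sum_add_distrib]; ring)
    (fun c x y => by simp only [ip, Prod.smul_fst, Prod.smul_snd, Pi.smul_apply, smul_eq_mul,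
      mul_left_comm _ c, ← Finset.mul_sum]; ring)

theorem ipForm_apply (x y : V) : ipForm x y = ip x y := rfl

theorem ip_comm (x y : V) : ip x y = ip y x := by
  simp only [ip, mul_comm]

/-- The Gram matrix of a family of vectors. -/
def gram {ι : Type*} (v : ι → V) : Matrix ι ι ℝ := Matrix.of fun i j => ip (v i) (v j)

theorem gram_linearCombination {ι κ : Type*} [Fintype κ] (A : Matrix ι κ ℝ) (v : κ → V) :
    gram (fun i => ∑ k, A i k • v k) = A * gram v * A.transpose := by
  ext i j
  simp only [gram, Matrix.of_apply, Matrix.mul_apply, Matrix.transpose_apply, ← ipForm_apply,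
    map_sum, map_smul, LinearMap.sum_apply, LinearMap.smul_apply, smul_eq_mul, Finset.mul_sum,
    Finset.sum_mul]
  refine Finset.sum_congr rfl fun k _ => Finset.sum_congr rfl fun l _ => by ring

/-- The vectors `e_i - e_n`, a basis of the root lattice `A_n ⊆ ℝ^(n+1)`. -/
def rootVec (n : ℕ) (i : Fin n) : Fin (n + 1) → ℝ :=
  Pi.single i.castSucc 1 - Pi.single (Fin.last n) 1

theorem rootVec_castSucc (n : ℕ) (i j : Fin n) :
    rootVec n i j.castSucc = if i = j then 1 else 0 := by
  simp [rootVec, Pi.single_apply, Fin.castSucc_ne_last, eq_comm]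

theorem rootVec_last (n : ℕ) (i : Fin n) : rootVec n i (Fin.last n) = -1 := by
  simp [rootVec, (Fin.castSucc_ne_last i).symm]

theorem sum_smul_rootVec_castSucc (n : ℕ) (c : Fin n → ℝ) (j : Fin n) :
    (∑ i, c i • rootVec n i) j.castSucc = c j := by
  simp [Finset.sum_apply, rootVec_castSucc]

theorem sum_smul_rootVec_last (n : ℕ) (c : Fin n → ℝ) :
    (∑ i, c i • rootVec n i) (Fin.last n) = -∑ i, c i := by
  simp [Finset.sum_apply, rootVec_last]

theorem eq_sum_smul_rootVec {n : ℕ} {x : Fin (n + 1) → ℝ} (hx : ∑ i, x i = 0) :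
    x = ∑ i : Fin n, x i.castSucc • rootVec n i := by
  ext j
  refine Fin.lastCases ?_ (fun j => ?_) j
  · rw [sum_smul_rootVec_last]
    rw [Fin.sum_univ_castSucc] at hx
    linarith
  · rw [sum_smul_rootVec_castSucc]

theorem rootVec_isInt (n : ℕ) (i : Fin n) (j : Fin (n + 1)) : ∃ z : ℤ, rootVec n i j = z := by
  refine Fin.lastCases ⟨-1, by simp [rootVec_last]⟩ (fun j => ?_) j
  exact ⟨if i = j then 1 else 0, by simp [rootVec_castSucc]⟩

theorem sum_rootVec_apply (n : ℕ) (i : Fin n) : ∑ j, rootVec n i j = 0 := by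
  simp [Fin.sum_univ_castSucc, rootVec_castSucc, rootVec_last]

theorem sum_rootVec_mul_rootVec (n : ℕ) (i j : Fin n) :
    ∑ t, rootVec n i t * rootVec n j t = (1 : Matrix (Fin n) (Fin n) ℝ) i j + 1 := by
  simp [Fin.sum_univ_castSucc, rootVec_castSucc, rootVec_last, Matrix.one_apply]

theorem det_one_add_ones (n : ℕ) :
    (1 + Matrix.of fun _ _ => 1 : Matrix (Fin n) (Fin n) ℝ).det = n + 1 := by
  have h := Matrix.det_one_add_replicateCol_mul_replicateRow (ι := Unit)
    (fun _ : Fin n => (1 : ℝ)) (fun _ => 1)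
  rw [show (1 + Matrix.of fun _ _ => 1 : Matrix (Fin n) (Fin n) ℝ) = 1 +
    Matrix.replicateCol Unit (fun _ : Fin n => (1 : ℝ)) *
      Matrix.replicateRow Unit (fun _ : Fin n => (1 : ℝ)) by
      ext; simp [Matrix.mul_apply], h]
  simp [dotProduct, add_comm]

/-- The index set of a basis of `L`. -/
abbrev RootIndex : Type := Fin 9 ⊕ Fin 9 ⊕ Fin 1

/-- A basis of `L` consisting of roots. -/
def rootBasis : RootIndex → V
  | .inl i => (rootVec 9 i, 0, 0)
  | .inr (.inl i) => (0, rootVec 9 i, 0)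
  | .inr (.inr i) => (0, 0, rootVec 1 i)

theorem gram_rootBasis :
    gram rootBasis = Matrix.fromBlocks (1 + Matrix.of fun _ _ => 1) 0 0
      (Matrix.fromBlocks (1 + Matrix.of fun _ _ => 1) 0 0 (1 + Matrix.of fun _ _ => 1)) := by
  ext (i | i | i) (j | j | j) <;>
    simp [gram, ip, rootBasis, sum_rootVec_mul_rootVec, -Fin.sum_univ_two, -Finset.univ_unique]

theorem det_gram_rootBasis : (gram rootBasis).det = 200 := by
  rw [gram_rootBasis, Matrix.det_fromBlocks_zero₂₁, Matrix.det_fromBlocks_zero₂₁,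
    det_one_add_ones, det_one_add_ones]
  norm_num

theorem rootBasis_mem (k : RootIndex) : rootBasis k ∈ Lset := by
  have h9 (i) : rootVec 9 i ∈ A9 := ⟨rootVec_isInt 9 i, sum_rootVec_apply 9 i⟩
  have h1 (i) : rootVec 1 i ∈ A1 := ⟨rootVec_isInt 1 i, sum_rootVec_apply 1 i⟩
  have z9 : (0 : Fin 10 → ℝ) ∈ A9 := ⟨fun _ => ⟨0, by simp⟩, by simp⟩
  have z1 : (0 : Fin 2 → ℝ) ∈ A1 := ⟨fun _ => ⟨0, by simp⟩, by simp⟩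
  rcases k with i | i | i
  · exact ⟨h9 i, z9, z1⟩
  · exact ⟨z9, h9 i, z1⟩
  · exact ⟨z9, z9, h1 i⟩

theorem sum_smul_rootBasis (c : RootIndex → ℝ) :
    ∑ k, c k • rootBasis k = (∑ i, c (.inl i) • rootVec 9 i,
      ∑ i, c (.inr (.inl i)) • rootVec 9 i, ∑ i, c (.inr (.inr i)) • rootVec 1 i) := by
  simp [Fintype.sum_sum_type, rootBasis, Prod.ext_iff, Prod.fst_sum, Prod.snd_sum,
    -Finset.univ_unique]

theorem exists_int_coeff_of_mem_Lset {v : V} (hv : v ∈ Lset) :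
    ∃ c : RootIndex → ℤ, v = ∑ k, (c k : ℝ) • rootBasis k := by
  obtain ⟨⟨hx, hx0⟩, ⟨hy, hy0⟩, ⟨hz, hz0⟩⟩ := hv
  choose x hx using hx
  choose y hy using hy
  choose z hz using hz
  refine ⟨Sum.elim (fun i => x i.castSucc) (Sum.elim (fun i => y i.castSucc)
    fun i => z i.castSucc), ?_⟩
  simp only [sum_smul_rootBasis, Sum.elim_inl, Sum.elim_inr, ← hx, ← hy, ← hz]
  rw [← eq_sum_smul_rootVec hx0, ← eq_sum_smul_rootVec hy0, ← eq_sum_smul_rootVec hz0]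

/-- The coordinates of `10 α` in the basis of roots. -/
def tenAlphaCoeff : RootIndex → ℤ :=
  Sum.elim (fun _ => 1) (Sum.elim (fun _ => 2) fun _ => 5)

theorem sum_α9 : ∑ i, α9 i = 0 := by
  simp only [α9, Fin.sum_univ_succ, Fin.val_succ]
  norm_num

theorem αvec_eq_sum : αvec = ∑ k, ((tenAlphaCoeff k : ℝ) / 10) • rootBasis k := by
  have h1 : ∑ i, α1 i = 0 := by
    simp [α1]
  rw [sum_smul_rootBasis, αvec]
  refine Prod.ext ?_ (Prod.ext ?_ ?_)
  · dsimp only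
    conv_lhs => rw [eq_sum_smul_rootVec sum_α9]
    refine Finset.sum_congr rfl fun i _ => ?_
    simp [tenAlphaCoeff, α9, i.isLt.ne]
  · dsimp only
    conv_lhs => rw [eq_sum_smul_rootVec sum_α9, Finset.smul_sum]
    refine Finset.sum_congr rfl fun i _ => ?_
    rw [smul_smul]
    congr 1
    simp [tenAlphaCoeff, α9, i.isLt.ne]
    norm_num
  · dsimp only
    conv_lhs => rw [eq_sum_smul_rootVec h1]
    refine Finset.sum_congr rfl fun i _ => ?_
    congr 1
    simp [tenAlphaCoeff, α1]
    norm_num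

/-- A basis of `Λ`: the basis of roots of `L` with its first vector replaced by `α`. -/
def glueBasis : RootIndex → V := Function.update rootBasis (.inl 0) αvec

theorem det_gram_glueBasis : (gram glueBasis).det = 2 := by
  let T : Matrix RootIndex RootIndex ℝ :=
    Matrix.updateRow 1 (.inl 0) fun k => (tenAlphaCoeff k : ℝ) / 10
  have hT : T.det = 1 / 10 := by
    rw [← Matrix.cramer_transpose_apply, Matrix.transpose_one, Matrix.cramer_one]
    simp [tenAlphaCoeff]
  have h : glueBasis = fun i => ∑ k, T i k • rootBasis k := by
    funext i
    by_cases hi : i = .inl 0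
    · subst hi
      simp only [glueBasis, Function.update_self, T, Matrix.updateRow_self]
      exact αvec_eq_sum
    · simp [glueBasis, Function.update_of_ne hi, T, Matrix.updateRow_ne hi, Matrix.one_apply]
  rw [h, gram_linearCombination, Matrix.det_mul, Matrix.det_mul, Matrix.det_transpose, hT,
    det_gram_rootBasis]
  norm_num

theorem αvec_mem : αvec ∈ Λset :=
  ⟨1, by
    rw [one_smul, sub_self]
    exact ⟨⟨fun _ => ⟨0, by simp⟩, by simp⟩, ⟨fun _ => ⟨0, by simp⟩, by simp⟩,
      ⟨fun _ => ⟨0, by simp⟩, by simp⟩⟩⟩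

theorem Lset_subset_Λset {v : V} (hv : v ∈ Lset) : v ∈ Λset :=
  ⟨0, by simpa using hv⟩

theorem glueBasis_mem (k : RootIndex) : glueBasis k ∈ Λset := by
  by_cases hk : k = .inl 0
  · subst hk
    simpa [glueBasis] using αvec_mem
  · rw [glueBasis, Function.update_of_ne hk]
    exact Lset_subset_Λset (rootBasis_mem k)

theorem exists_int_coeff_of_mem_Λset {v : V} (hv : v ∈ Λset) :
    ∃ c : RootIndex → ℤ, v = ∑ k, (c k : ℝ) • glueBasis k := by
  obtain ⟨m, hm⟩ := hv
  obtain ⟨x, hx⟩ := exists_int_coeff_of_mem_Lset hm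
  let k₀ : RootIndex := .inl 0
  let d : RootIndex → ℤ := fun k => x k - x k₀ * tenAlphaCoeff k
  have hd : d k₀ = 0 := by simp [d, k₀, tenAlphaCoeff]
  have hsum : ∑ k, (d k : ℝ) • rootBasis k = v - m • αvec - (10 * x k₀ : ℝ) • αvec := by
    conv_rhs => rw [hx, αvec_eq_sum, Finset.smul_sum, ← Finset.sum_sub_distrib]
    refine Finset.sum_congr rfl fun k _ => ?_
    rw [smul_smul, ← sub_smul]
    congr 1
    simp only [d]
    push_cast
    ring
  refine ⟨Function.update d k₀ (m + 10 * x k₀), ?_⟩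
  have hterm : ∀ k ∈ Finset.univ.erase k₀,
      ((Function.update d k₀ (m + 10 * x k₀) k : ℤ) : ℝ) • glueBasis k =
        (d k : ℝ) • rootBasis k := by
    intro k hk
    have hk := Finset.ne_of_mem_erase hk
    rw [Function.update_of_ne hk, glueBasis, Function.update_of_ne hk]
  rw [← Finset.add_sum_erase _ _ (Finset.mem_univ k₀)] at hsum
  rw [← Finset.add_sum_erase _ _ (Finset.mem_univ k₀), Finset.sum_congr rfl hterm]
  rw [hd, Int.cast_zero, zero_smul, zero_add] at hsum
  rw [hsum, Function.update_self, glueBasis, Function.update_self, ← Int.cast_smul_eq_zsmul ℝ]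
  push_cast
  rw [add_smul]
  abel

/-- The Gram determinant of a `ℤ`-basis of the lattice spanned by `v` agrees with that of `v`. -/
theorem det_gram_eq_of_int_coeff {ι κ : Type*} [Fintype ι] [DecidableEq ι] [Fintype κ]
    [DecidableEq κ] (σ : ι ≃ κ) {b : ι → V} {v : κ → V} (P : Matrix ι κ ℤ) (Q : Matrix κ ι ℤ)
    (hP : ∀ i, b i = ∑ k, (P i k : ℝ) • v k) (hPQ : P * Q = 1) :
    (gram b).det = (gram v).det := by
  let P' : Matrix ι ι ℤ := P.submatrix id σ
  have hdet : P'.det * (Q.submatrix σ id).det = 1 := by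
    rw [← Matrix.det_mul, Matrix.submatrix_mul_equiv, hPQ, Matrix.submatrix_id_id, Matrix.det_one]
  have hsq : P'.det * P'.det = 1 := Int.isUnit_mul_self (IsUnit.of_mul_eq_one _ hdet)
  have hb : b = fun i => ∑ j, P'.map (Int.cast : ℤ → ℝ) i j • v (σ j) := by
    funext i
    rw [hP, ← σ.sum_comp]
    rfl
  have hv : (gram fun j => v (σ j)).det = (gram v).det :=
    Matrix.det_submatrix_equiv_self σ (gram v)
  have hc : (P'.map (Int.cast : ℤ → ℝ)).det = (P'.det : ℝ) := ((Int.castRingHom ℝ).map_det P').symm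
  rw [hb, gram_linearCombination, Matrix.det_mul, Matrix.det_mul, Matrix.det_transpose, hv, hc,
    mul_right_comm, ← Int.cast_mul, hsq, Int.cast_one, one_mul]

theorem ip_αvec_of_mem_Lset {l : V} (hl : l ∈ Lset) :
    ip αvec l = -(l.1 9 + 2 * l.2.1 9 + l.2.2 1) := by
  obtain ⟨⟨-, hx⟩, ⟨-, hy⟩, ⟨-, hz⟩⟩ := hl
  have h9 (x : Fin 10 → ℝ) (hx : ∑ i, x i = 0) : ∑ i, α9 i * x i = -x 9 := by
    have h : ∀ i : Fin 10, α9 i * x i = 1 / 10 * x i - if i = 9 then x i else 0 := by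
      intro i
      by_cases hi : i = 9
      · subst hi; simp [α9]; ring
      · have : (i : ℕ) ≠ 9 := fun h => hi (Fin.ext h)
        simp [α9, hi, this]
    rw [Finset.sum_congr rfl fun i _ => h i, Finset.sum_sub_distrib, ← Finset.mul_sum, hx]
    simp
  simp only [ip, αvec, Pi.smul_apply, smul_eq_mul, mul_assoc, ← Finset.mul_sum, h9 _ hx, h9 _ hy]
  rw [Fin.sum_univ_two] at hz ⊢
  simp only [α1, Fin.val_zero, Fin.val_one]
  norm_num
  linarith

theorem ip_αvec_αvec : ip αvec αvec = 5 := by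
  simp only [ip, αvec, α9, α1, Fin.sum_univ_succ, Fin.val_succ, Pi.smul_apply, smul_eq_mul]
  norm_num

theorem ip_isInt_of_mem_Lset {u v : V} (hu : u ∈ Lset) (hv : v ∈ Lset) :
    ∃ z : ℤ, ip u v = z := by
  obtain ⟨⟨hu₁, -⟩, ⟨hu₂, -⟩, ⟨hu₃, -⟩⟩ := hu
  obtain ⟨⟨hv₁, -⟩, ⟨hv₂, -⟩, ⟨hv₃, -⟩⟩ := hv
  choose x₁ hx₁ using hu₁
  choose x₂ hx₂ using hu₂
  choose x₃ hx₃ using hu₃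
  choose y₁ hy₁ using hv₁
  choose y₂ hy₂ using hv₂
  choose y₃ hy₃ using hv₃
  refine ⟨∑ t, x₁ t * y₁ t + ∑ t, x₂ t * y₂ t + ∑ t, x₃ t * y₃ t, ?_⟩
  simp only [ip, hx₁, hx₂, hx₃, hy₁, hy₂, hy₃]
  push_cast
  rfl

theorem ip_αvec_isInt_of_mem_Lset {l : V} (hl : l ∈ Lset) : ∃ z : ℤ, ip αvec l = z := by
  obtain ⟨x, hx⟩ := hl.1.1 9
  obtain ⟨y, hy⟩ := hl.2.1.1 9
  obtain ⟨z, hz⟩ := hl.2.2.1 1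
  refine ⟨-(x + 2 * y + z), ?_⟩
  rw [ip_αvec_of_mem_Lset hl, hx, hy, hz]
  push_cast
  rfl

theorem ip_isInt_of_mem_Λset {u v : V} (hu : u ∈ Λset) (hv : v ∈ Λset) :
    ∃ z : ℤ, ip u v = z := by
  obtain ⟨m, hm⟩ := hu
  obtain ⟨n, hn⟩ := hv
  obtain ⟨a, ha⟩ := ip_isInt_of_mem_Lset hm hn
  obtain ⟨b, hb⟩ := ip_αvec_isInt_of_mem_Lset hm
  obtain ⟨c, hc⟩ := ip_αvec_isInt_of_mem_Lset hn
  refine ⟨a + n * b + m * c + 5 * m * n, ?_⟩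
  have h : ip u v = ip (u - m • αvec) (v - n • αvec) + n * ip αvec (u - m • αvec) +
      m * ip αvec (v - n • αvec) + m * n * ip αvec αvec := by
    rw [ip_comm αvec (u - m • αvec)]
    simp only [← ipForm_apply, ← Int.cast_smul_eq_zsmul ℝ, map_sub, map_smul,
      LinearMap.sub_apply, LinearMap.smul_apply, smul_eq_mul]
    ring
  rw [h, ha, hb, hc, ip_αvec_αvec]
  push_cast
  ring

theorem ten_smul_αvec_mem : (10 : ℤ) • αvec ∈ Lset := by
  refine ⟨⟨fun i => ⟨if (i : ℕ) = 9 then -9 else 1, ?_⟩, ?_⟩,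
    ⟨fun i => ⟨if (i : ℕ) = 9 then -18 else 2, ?_⟩, ?_⟩,
    ⟨fun i => ⟨if (i : ℕ) = 1 then -5 else 5, ?_⟩, ?_⟩⟩
  · simp only [αvec, Prod.smul_fst, Pi.smul_apply, α9]
    split_ifs <;> norm_num
  · simp [αvec, ← Finset.mul_sum, sum_α9]
  · simp only [αvec, Prod.smul_fst, Prod.smul_snd, Pi.smul_apply, α9]
    split_ifs <;> norm_num
  · simp [αvec, ← Finset.mul_sum, sum_α9]
  · simp only [αvec, Prod.smul_snd, Pi.smul_apply, α1]
    split_ifs <;> norm_num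
  · simp [αvec, α1]

theorem Λset_subset_span {v : V} (hv : v ∈ Λset) : v ∈ Submodule.span ℝ Lset := by
  obtain ⟨m, hm⟩ := hv
  have hα : αvec ∈ Submodule.span ℝ Lset := by
    have h := (Submodule.span ℝ Lset).smul_mem (1 / 10 : ℝ)
      (Submodule.subset_span ten_smul_αvec_mem)
    rw [← Int.cast_smul_eq_zsmul ℝ, smul_smul] at h
    norm_num at h
    exact h
  rw [← sub_add_cancel v (m • αvec)]
  exact add_mem (Submodule.subset_span hm) (zsmul_mem hα m)

theorem ten_dvd_of_smul_αvec_mem {m : ℤ} (hm : m • αvec ∈ Lset) : (10 : ℤ) ∣ m := by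
  obtain ⟨z, hz⟩ := hm.1.1 0
  refine ⟨z, ?_⟩
  have h : (m : ℝ) * (1 / 10) = z := by simpa [αvec, α9] using hz
  have : (m : ℝ) = 10 * z := by linarith
  exact_mod_cast this

theorem det_gram_of_basis {b : Fin 19 → V} (hb : ∀ i, b i ∈ Λset)
    (hbasis : ∀ x ∈ Λset, ∃! c : Fin 19 → ℤ, x = ∑ i, (c i : ℝ) • b i) :
    (gram b).det = 2 := by
  choose P hP using fun i => exists_int_coeff_of_mem_Λset (hb i)
  choose Q hQ using fun k => (hbasis _ (glueBasis_mem k)).exists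
  rw [← det_gram_glueBasis]
  refine det_gram_eq_of_int_coeff (Fintype.equivOfCardEq (by simp)) (Matrix.of P) (Matrix.of Q)
    hP ?_
  ext i j
  refine congrFun ((hbasis _ (hb i)).unique (y₁ := (Matrix.of P * Matrix.of Q) i)
    (y₂ := (1 : Matrix (Fin 19) (Fin 19) ℤ) i) ?_ ?_) j
  · conv_lhs => rw [hP i]
    simp only [hQ, Matrix.mul_apply, Matrix.of_apply, Int.cast_sum, Int.cast_mul, Finset.sum_smul,
      Finset.smul_sum, smul_smul]
    exact Finset.sum_comm
  · simp [Matrix.one_apply]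

/-- With L = A₉ ⊕ A₉ ⊕ A₁, α = (α₉, 2α₉, α₁) and Λ = L + ℤα:
Λ is an integral lattice, Λ ⊆ L^*, the discriminant of Λ is 2 (the Gram determinant of any
ℤ-basis of Λ is 2), and Λ/L is cyclic of order 10, generated by the coset of α. -/
theorem stmt5 :
    (∀ u ∈ Λset, ∀ v ∈ Λset, ∃ z : ℤ, ip u v = (z : ℝ)) ∧
    (∀ v ∈ Λset, v ∈ Submodule.span ℝ Lset ∧ ∀ l ∈ Lset, ∃ z : ℤ, ip v l = (z : ℝ)) ∧
    (∀ b : Fin 19 → V, (∀ i, b i ∈ Λset) →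
      (∀ x ∈ Λset, ∃! c : Fin 19 → ℤ, x = ∑ i, (c i : ℝ) • b i) →
      Matrix.det (Matrix.of fun i j => ip (b i) (b j)) = 2) ∧
    (∀ v ∈ Λset, ∃ m : ℤ, v - m • αvec ∈ Lset) ∧
    ((10 : ℤ) • αvec ∈ Lset) ∧
    (∀ m : ℤ, m • αvec ∈ Lset → (10 : ℤ) ∣ m) := by
  exact ⟨fun _ hu _ hv => ip_isInt_of_mem_Λset hu hv,
    fun _ hv => ⟨Λset_subset_span hv, fun _ hl => ip_isInt_of_mem_Λset hv (Lset_subset_Λset hl)⟩,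
    fun _ hb hbasis => det_gram_of_basis hb hbasis,
    fun _ hv => hv,
    ten_smul_αvec_mem,
    fun _ hm => ten_dvd_of_smul_αvec_mem hm⟩

end
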